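/- For every real $m \geq 2$, writing $x := \frac{\log m}{\log 2} \geq 1$, one has $\log m \cdot \sum_{q \geq 2} \frac{\Lambda(q)}{q \log^2(mq)} \leq \sum_{j \geq 1} \frac{x}{(x+j)^2} \leq \frac{x}{x + \tfrac{1}{2}} \leq 1$, where the sum over $q$ is over natural numbers $q \geq 2$. -/

import Mathlib

open MeasureTheory Set in
lemma lintegral_mul_exp_neg_mul_Ioi {a : ℝ} (ha : 0 < a) :
    ∫⁻ s in Ioi (0 : ℝ), ENNReal.ofReal (s * Real.exp (-(a * s))) = ENNReal.ofReal (1 / a ^ 2) := by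
  have key : ∫ s in Ioi (0 : ℝ), s * Real.exp (-(a * s)) = 1 / a ^ 2 := by
    have h := Real.integral_rpow_mul_exp_neg_mul_Ioi (a := 2) (r := a) two_pos ha
    rw [Real.Gamma_two, mul_one, Real.rpow_two, div_pow, one_pow] at h
    rw [← h]
    norm_num
  rw [← key, ofReal_integral_eq_lintegral_ofReal]
  · exact .of_integral_ne_zero (by rw [key]; positivity)
  · filter_upwards [ae_restrict_mem measurableSet_Ioi] with s hs
    have : 0 < s := hs
    positivity

lemma LSeries_term_ofReal {f : ℕ → ℝ} {σ : ℝ} (hσ : σ ≠ 0) (n : ℕ) :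
    LSeries.term (fun n ↦ (f n : ℂ)) σ n = ((f n / (n : ℝ) ^ σ : ℝ) : ℂ) := by
  rcases eq_or_ne n 0 with rfl | hn
  · simp [Real.zero_rpow hσ]
  · rw [LSeries.term_of_ne_zero hn, Complex.ofReal_div, Complex.ofReal_cpow n.cast_nonneg]
    simp

lemma LSeriesSummable_ofReal_iff {f : ℕ → ℝ} {σ : ℝ} (hσ : σ ≠ 0) :
    LSeriesSummable (fun n ↦ (f n : ℂ)) σ ↔ Summable fun n : ℕ ↦ f n / (n : ℝ) ^ σ := by
  rw [LSeriesSummable, funext (LSeries_term_ofReal hσ), Complex.summable_ofReal]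

lemma LSeries_ofReal {f : ℕ → ℝ} {σ : ℝ} (hσ : σ ≠ 0) :
    LSeries (fun n ↦ (f n : ℂ)) σ = ((∑' n : ℕ, f n / (n : ℝ) ^ σ : ℝ) : ℂ) := by
  rw [LSeries, funext (LSeries_term_ofReal hσ), Complex.ofReal_tsum]

lemma summable_vonMangoldt_div_rpow {σ : ℝ} (hσ : 1 < σ) :
    Summable fun n : ℕ ↦ ArithmeticFunction.vonMangoldt n / (n : ℝ) ^ σ :=
  (LSeriesSummable_ofReal_iff (by linarith)).mp
    (ArithmeticFunction.LSeriesSummable_vonMangoldt (by simpa using hσ))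

lemma summable_log_div_rpow {σ : ℝ} (hσ : 1 < σ) :
    Summable fun n : ℕ ↦ Real.log n / (n : ℝ) ^ σ := by
  have h := (ArithmeticFunction.LSeriesSummable_vonMangoldt (s := σ) (by simpa using hσ)).convolution
    ((LSeriesSummable_one_iff (s := σ)).mpr (by simpa using hσ))
  rw [ArithmeticFunction.convolution_vonMangoldt_const_one] at h
  simp_rw [← Complex.natCast_log] at h
  exact (LSeriesSummable_ofReal_iff (by linarith)).mp h

lemma tsum_vonMangoldt_mul_tsum {σ : ℝ} (hσ : 1 < σ) :
    (∑' n : ℕ, ArithmeticFunction.vonMangoldt n / (n : ℝ) ^ σ) * ∑' n : ℕ, 1 / (n : ℝ) ^ σ =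
      ∑' n : ℕ, Real.log n / (n : ℝ) ^ σ := by
  have h0 : σ ≠ 0 := by linarith
  have h := LSeries_convolution'
    (ArithmeticFunction.LSeriesSummable_vonMangoldt (s := σ) (by simpa using hσ))
    ((LSeriesSummable_one_iff (s := σ)).mpr (by simpa using hσ))
  rw [ArithmeticFunction.convolution_vonMangoldt_const_one] at h
  simp_rw [← Complex.natCast_log] at h
  have h1 : (1 : ℕ → ℂ) = fun n ↦ (((fun _ ↦ 1 : ℕ → ℝ) n : ℝ) : ℂ) := by ext; simp
  rw [h1, LSeries_ofReal h0, LSeries_ofReal h0, LSeries_ofReal h0] at h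
  exact_mod_cast h.symm

/-- The first two pairs of terms of the derivative of the Dirichlet eta function. -/
lemma log_three_add_log_five_div_rpow_le {σ : ℝ} (hσ : 1 ≤ σ) :
    Real.log 3 / 3 ^ σ + Real.log 5 / 5 ^ σ ≤ Real.log 2 / 2 ^ σ + Real.log 4 / 4 ^ σ := by
  obtain ⟨s, hs, rfl⟩ : ∃ s : ℝ, 0 ≤ s ∧ σ = 1 + s := ⟨σ - 1, by linarith, by ring⟩
  have key : ∀ b : ℝ, 0 < b →
      Real.log b / b ^ (1 + s) = Real.log b / b * (2 / b) ^ s / 2 ^ s := fun b hb ↦ by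
    rw [Real.rpow_add hb, Real.rpow_one, Real.div_rpow two_pos.le hb.le]
    field_simp
  rw [key 2 two_pos, key 3 (by norm_num), key 4 (by norm_num), key 5 (by norm_num),
    ← add_div, ← add_div, Real.log_four_eq]
  refine div_le_div_of_nonneg_right ?_ (by positivity)
  have h45 : ((2 : ℝ) / 5) ^ s ≤ (2 / 4) ^ s := by gcongr; norm_num
  have hu1 : ((2 : ℝ) / 3) ^ s ≤ 1 := Real.rpow_le_one (by norm_num) (by norm_num) hs
  have hu2 : (((2 : ℝ) / 3) ^ s) ^ 2 ≤ (2 / 4) ^ s := by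
    rw [← Real.rpow_natCast, ← Real.rpow_mul (by norm_num), mul_comm, Real.rpow_mul (by norm_num)]
    gcongr
    norm_num
  have hu0 : 0 < ((2 : ℝ) / 3) ^ s := by positivity
  rw [div_self two_ne_zero, Real.one_rpow]
  have hw0 : 0 < ((2 : ℝ) / 5) ^ s := by positivity
  generalize ((2 : ℝ) / 3) ^ s = u at *
  generalize ((2 : ℝ) / 4) ^ s = v at *
  generalize ((2 : ℝ) / 5) ^ s = w at *
  have l2 := Real.log_two_gt_d9
  have l3 := Real.log_three_lt_d9
  have l5 := Real.log_five_lt_d9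
  have a : Real.log 3 / 3 * u ≤ 0.3663 * u := by gcongr; linarith
  have b : Real.log 5 / 5 * w ≤ 0.3219 * v := by
    have : Real.log 5 / 5 ≤ 0.3219 := by linarith
    have := Real.log_pos (show (1 : ℝ) < 5 by norm_num)
    gcongr
  have c : 0.3465 * v ≤ 2 * Real.log 2 / 4 * v := by
    have : 0 ≤ v := by nlinarith
    gcongr; linarith
  nlinarith

lemma summable_log_even_div_rpow {σ : ℝ} (hσ : 1 < σ) :
    Summable fun k : ℕ ↦ Real.log (2 * k : ℕ) / ((2 * k : ℕ) : ℝ) ^ σ :=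
  (summable_log_div_rpow hσ).comp_injective fun a b (h : 2 * a = 2 * b) ↦ by omega

lemma summable_log_odd_div_rpow {σ : ℝ} (hσ : 1 < σ) :
    Summable fun k : ℕ ↦ Real.log (2 * k + 1 : ℕ) / ((2 * k + 1 : ℕ) : ℝ) ^ σ :=
  (summable_log_div_rpow hσ).comp_injective fun a b (h : 2 * a + 1 = 2 * b + 1) ↦ by omega

lemma tsum_log_odd_le_tsum_log_even {σ : ℝ} (hσ : 1 < σ) :
    ∑' k : ℕ, Real.log (2 * k + 1 : ℕ) / ((2 * k + 1 : ℕ) : ℝ) ^ σ ≤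
      ∑' k : ℕ, Real.log (2 * k : ℕ) / ((2 * k : ℕ) : ℝ) ^ σ := by
  have he := summable_log_even_div_rpow hσ
  have ho := summable_log_odd_div_rpow hσ
  rw [← sub_nonneg, ← he.tsum_sub ho]
  refine le_trans ?_ ((he.sub ho).sum_le_tsum (Finset.range 3) fun k hk ↦ ?_)
  · have := log_three_add_log_five_div_rpow_le hσ.le
    simp only [Finset.sum_range_succ, Finset.sum_range_zero]
    norm_num
    linarith
  · have hk : 3 ≤ k := by simpa using hk
    have hk' : (3 : ℝ) ≤ k := mod_cast hk
    have h1 : Real.exp σ⁻¹ ≤ 3 :=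
      (Real.exp_le_exp.mpr (inv_le_one_of_one_le₀ hσ.le)).trans
        (Real.exp_one_lt_d9.le.trans (by norm_num))
    rw [sub_nonneg]
    refine Real.log_div_self_rpow_antitoneOn (by linarith : 0 < σ) ?_ ?_ ?_ <;>
      simp <;> linarith

lemma tsum_vonMangoldt_div_rpow_le {s : ℝ} (hs : 0 < s) :
    ∑' n : ℕ, ArithmeticFunction.vonMangoldt n / (n : ℝ) ^ (1 + s) ≤
      ∑' j : ℕ, Real.log 2 * ((2 : ℝ) ^ (-s)) ^ (j + 1) := by
  have hσ : 1 < 1 + s := by linarith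
  have hlog := summable_log_div_rpow hσ
  have hone : Summable fun n : ℕ ↦ 1 / (n : ℝ) ^ (1 + s) := Real.summable_one_div_nat_rpow.mpr hσ
  have hmul := tsum_vonMangoldt_mul_tsum hσ
  have hle := tsum_log_odd_le_tsum_log_even hσ
  have hsplit := tsum_even_add_odd (f := fun n : ℕ ↦ Real.log n / (n : ℝ) ^ (1 + s))
    (summable_log_even_div_rpow hσ) (summable_log_odd_div_rpow hσ)
  have heven : ∑' k : ℕ, Real.log (2 * k : ℕ) / ((2 * k : ℕ) : ℝ) ^ (1 + s) =
      2 ^ (-s) / 2 * (Real.log 2 * ∑' n : ℕ, 1 / (n : ℝ) ^ (1 + s) +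
        ∑' n : ℕ, Real.log n / (n : ℝ) ^ (1 + s)) := by
    rw [← tsum_mul_left, ← (hone.mul_left _).tsum_add hlog, ← tsum_mul_left]
    refine tsum_congr fun k ↦ ?_
    rcases eq_or_ne k 0 with rfl | hk
    · simp [Real.zero_rpow (by linarith : 1 + s ≠ 0)]
    · have : (0 : ℝ) < k := by positivity
      rw [Nat.cast_mul, Nat.cast_ofNat, Real.log_mul two_ne_zero this.ne',
        Real.mul_rpow two_pos.le this.le, Real.rpow_add two_pos, Real.rpow_one, Real.rpow_neg two_pos.le]
      field_simp
  have hZ : 0 < ∑' n : ℕ, 1 / (n : ℝ) ^ (1 + s) :=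
    hone.tsum_pos (fun n ↦ by positivity) 1 (by simp)
  have hr0 : 0 < (2 : ℝ) ^ (-s) := by positivity
  have hr1 : (2 : ℝ) ^ (-s) < 1 := Real.rpow_lt_one_of_one_lt_of_neg one_lt_two (by linarith)
  simp_rw [pow_succ']
  rw [tsum_mul_left, tsum_mul_left, tsum_geometric_of_lt_one hr0.le hr1, ← mul_assoc,
    ← div_eq_mul_inv, le_div_iff₀ (by linarith)]
  refine le_of_mul_le_mul_right ?_ hZ
  rw [mul_right_comm, hmul]
  linarith

lemma sum_range_div_add_sq_le {x : ℝ} (hx : 0 < x) (n : ℕ) :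
    ∑ j ∈ Finset.range n, x / (x + ((j : ℝ) + 1)) ^ 2 ≤ x / (x + 1 / 2) - x / (x + n + 1 / 2) := by
  induction n with
  | zero => simp
  | succ n ih =>
    rw [Finset.sum_range_succ]
    have h : x / (x + ((n : ℝ) + 1)) ^ 2 ≤
        x / (x + n + 1 / 2) - x / (x + (n + 1 : ℕ) + 1 / 2) := by
      rw [div_sub_div _ _ (by positivity) (by positivity),
        div_le_div_iff₀ (by positivity) (by positivity)]
      push_cast
      nlinarith
    linarith

lemma sum_range_div_add_sq_le_div {x : ℝ} (hx : 0 < x) (n : ℕ) :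
    ∑ j ∈ Finset.range n, x / (x + ((j : ℝ) + 1)) ^ 2 ≤ x / (x + 1 / 2) :=
  (sum_range_div_add_sq_le hx n).trans (sub_le_self _ (by positivity))

/-- Integral form of `tsum_vonMangoldt_div_rpow_le`, against the weight `s * m ^ (-s)`. -/
lemma tsum_ofReal_vonMangoldt_le {m : ℝ} (hm : 1 < m) :
    ∑' q : ℕ, ENNReal.ofReal
        (ArithmeticFunction.vonMangoldt q / ((q : ℝ) * Real.log (m * q) ^ 2)) ≤
      ∑' j : ℕ, ENNReal.ofReal (Real.log 2 / (Real.log m + (j + 1) * Real.log 2) ^ 2) := by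
  have hlm := Real.log_pos hm
  have hl2 := Real.log_pos one_lt_two
  have hq : ∀ q : ℕ, ENNReal.ofReal
      (ArithmeticFunction.vonMangoldt q / ((q : ℝ) * Real.log (m * q) ^ 2)) =
      ∫⁻ s in Set.Ioi (0 : ℝ), ENNReal.ofReal (ArithmeticFunction.vonMangoldt q / q) *
        ENNReal.ofReal (s * Real.exp (-(Real.log (m * q) * s))) := fun q ↦ by
    rw [MeasureTheory.lintegral_const_mul _ (by fun_prop)]
    rcases eq_or_ne q 0 with rfl | hq0
    · simp
    have hq1 : (1 : ℝ) ≤ q := mod_cast Nat.one_le_iff_ne_zero.mpr hq0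
    rw [lintegral_mul_exp_neg_mul_Ioi (Real.log_pos (by nlinarith)), ← ENNReal.ofReal_mul
      (div_nonneg ArithmeticFunction.vonMangoldt_nonneg q.cast_nonneg), div_mul_div_comm, mul_one]
  have hj : ∀ j : ℕ, ENNReal.ofReal (Real.log 2 / (Real.log m + (j + 1) * Real.log 2) ^ 2) =
      ∫⁻ s in Set.Ioi (0 : ℝ), ENNReal.ofReal (Real.log 2) *
        ENNReal.ofReal (s * Real.exp (-((Real.log m + (j + 1) * Real.log 2) * s))) := fun j ↦ by
    rw [MeasureTheory.lintegral_const_mul _ (by fun_prop),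
      lintegral_mul_exp_neg_mul_Ioi (by positivity), ← ENNReal.ofReal_mul hl2.le, mul_one_div]
  simp_rw [hq, hj]
  rw [← MeasureTheory.lintegral_tsum fun _ ↦ by fun_prop,
    ← MeasureTheory.lintegral_tsum fun _ ↦ by fun_prop]
  refine MeasureTheory.setLIntegral_mono' measurableSet_Ioi fun s (hs : 0 < s) ↦ ?_
  have hw : 0 ≤ s * Real.exp (-(Real.log m * s)) := by positivity
  have hl : ∀ q : ℕ, ENNReal.ofReal (ArithmeticFunction.vonMangoldt q / q) *
      ENNReal.ofReal (s * Real.exp (-(Real.log (m * q) * s))) =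
      ENNReal.ofReal (s * Real.exp (-(Real.log m * s))) *
        ENNReal.ofReal (ArithmeticFunction.vonMangoldt q / (q : ℝ) ^ (1 + s)) := fun q ↦ by
    rcases eq_or_ne q 0 with rfl | hq0
    · simp
    have hq1 : (0 : ℝ) < q := by positivity
    rw [← ENNReal.ofReal_mul hw, ← ENNReal.ofReal_mul
      (div_nonneg ArithmeticFunction.vonMangoldt_nonneg q.cast_nonneg),
      Real.log_mul (by positivity) hq1.ne', add_mul, neg_add, Real.exp_add,
      Real.rpow_add hq1, Real.rpow_one, Real.rpow_def_of_pos hq1, Real.exp_neg (_ * s),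
      Real.exp_neg (_ * s)]
    congr 1
    field_simp
  have hr : ∀ j : ℕ, ENNReal.ofReal (Real.log 2) *
      ENNReal.ofReal (s * Real.exp (-((Real.log m + (j + 1) * Real.log 2) * s))) =
      ENNReal.ofReal (s * Real.exp (-(Real.log m * s))) *
        ENNReal.ofReal (Real.log 2 * ((2 : ℝ) ^ (-s)) ^ (j + 1)) := fun j ↦ by
    rw [← ENNReal.ofReal_mul hw, ← ENNReal.ofReal_mul hl2.le, Real.rpow_def_of_pos two_pos,
      ← Real.exp_nat_mul, add_mul, neg_add, Real.exp_add]
    congr 1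
    have : -((j + 1) * Real.log 2 * s) = ((j + 1 : ℕ) : ℝ) * (Real.log 2 * -s) := by
      push_cast; ring
    rw [this]
    ring
  simp_rw [hl, hr]
  rw [ENNReal.tsum_mul_left, ENNReal.tsum_mul_left]
  refine mul_le_mul' le_rfl ?_
  rw [← ENNReal.ofReal_tsum_of_nonneg
      (fun _ ↦ div_nonneg ArithmeticFunction.vonMangoldt_nonneg (by positivity))
      (summable_vonMangoldt_div_rpow (by linarith)),
    ← ENNReal.ofReal_tsum_of_nonneg (fun _ ↦ by positivity)]
  · exact ENNReal.ofReal_le_ofReal (tsum_vonMangoldt_div_rpow_le hs)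
  · exact ((summable_nat_add_iff 1).mpr (summable_geometric_of_lt_one (by positivity)
      (Real.rpow_lt_one_of_one_lt_of_neg one_lt_two (by linarith)))).mul_left _

theorem vonMangoldt_nonasymptotic_estimate (m x : ℝ) (hm : 2 ≤ m)
    (hx : x = Real.log m / Real.log 2) :
    Real.log m * (∑' q : ℕ, if 2 ≤ q then
        ArithmeticFunction.vonMangoldt q / ((q : ℝ) * (Real.log (m * q)) ^ 2) else 0) ≤
      (∑' j : ℕ, x / (x + ((j : ℝ) + 1)) ^ 2) ∧
    (∑' j : ℕ, x / (x + ((j : ℝ) + 1)) ^ 2) ≤ x / (x + 1 / 2) ∧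
    x / (x + 1 / 2) ≤ 1 := by
  have hl2 := Real.log_pos one_lt_two
  have hlm : 0 < Real.log m := Real.log_pos (by linarith)
  have hx0 : 0 < x := hx ▸ div_pos hlm hl2
  have hnonneg : ∀ j : ℕ, 0 ≤ x / (x + ((j : ℝ) + 1)) ^ 2 := fun j ↦ by positivity
  refine ⟨?_, Real.tsum_le_of_sum_range_le hnonneg (sum_range_div_add_sq_le_div hx0),
    div_le_one_of_le₀ (by linarith) (by positivity)⟩
  have hif : ∀ q : ℕ, (if 2 ≤ q then
      ArithmeticFunction.vonMangoldt q / ((q : ℝ) * (Real.log (m * q)) ^ 2) else 0) =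
      ArithmeticFunction.vonMangoldt q / ((q : ℝ) * (Real.log (m * q)) ^ 2) := fun q ↦ by
    split_ifs with h
    · rfl
    · obtain rfl | rfl : q = 0 ∨ q = 1 := by omega
      all_goals simp
  have hterm : ∀ j : ℕ, x / (x + ((j : ℝ) + 1)) ^ 2 =
      Real.log m * (Real.log 2 / (Real.log m + (j + 1) * Real.log 2) ^ 2) := fun j ↦ by
    have hxm : Real.log m = x * Real.log 2 := by rw [hx]; field_simp
    rw [hxm, ← add_mul]
    field_simp
  have hsum := summable_of_sum_range_le hnonneg (sum_range_div_add_sq_le_div hx0)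
  simp_rw [hterm] at hsum ⊢
  rw [summable_mul_left_iff hlm.ne'] at hsum
  simp_rw [hif]
  rw [tsum_mul_left]
  refine mul_le_mul_of_nonneg_left ?_ hlm.le
  have hle := tsum_ofReal_vonMangoldt_le (by linarith : 1 < m)
  rw [← ENNReal.ofReal_tsum_of_nonneg (fun _ ↦ by positivity) hsum] at hle
  have hle' := ENNReal.toReal_mono ENNReal.ofReal_ne_top hle
  rw [ENNReal.toReal_ofReal (tsum_nonneg fun _ ↦ by positivity), ENNReal.tsum_toReal_eq
    fun _ ↦ ENNReal.ofReal_ne_top] at hle'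
  refine (tsum_congr fun q ↦ ?_).trans_le hle'
  exact (ENNReal.toReal_ofReal
    (div_nonneg ArithmeticFunction.vonMangoldt_nonneg (by positivity))).symm
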